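/- arXiv:1709.10103 — 12 statements merged into one kernel-verified Lean document; each statement's English description precedes it below -/
import Mathlib

section
/- Let U ⊆ ℂ × ℂ be open and let α, β, p : U → ℂ be differentiable functions. At every point z ∈ U where f := β − α·p satisfies f(z) ≠ 0, one has the identity ∂x(1/f)(z) + ∂y(p/f)(z) = E(z)/f(z)², where E := −∂xβ + (∂xα − ∂yβ)·p + ∂yα·p² + α·∂xp + β·∂yp. -/
/-- Partial derivative in the x-direction on `ℂ × ℂ`. -/
noncomputable def pdx (f : ℂ × ℂ → ℂ) (z : ℂ × ℂ) : ℂ := fderiv ℂ f z (1, 0)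

/-- Partial derivative in the y-direction on `ℂ × ℂ`. -/
noncomputable def pdy (f : ℂ × ℂ → ℂ) (z : ℂ × ℂ) : ℂ := fderiv ℂ f z (0, 1)

/-- At every point where `f := β - α·p` does not vanish,
`∂x(1/f) + ∂y(p/f) = E/f²` where `E` is the symmetry expression of the
vector field `X = α∂x + β∂y` with respect to the slope function `p`. -/
theorem symmetry_expression_gives_closedness
    (U : Set (ℂ × ℂ)) (hU : IsOpen U)
    (α β p : ℂ × ℂ → ℂ)
    (hα : DifferentiableOn ℂ α U) (hβ : DifferentiableOn ℂ β U)
    (hp : DifferentiableOn ℂ p U)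
    (z : ℂ × ℂ) (hz : z ∈ U) (hf : β z - α z * p z ≠ 0) :
    pdx (fun w => 1 / (β w - α w * p w)) z +
      pdy (fun w => p w / (β w - α w * p w)) z =
    (-pdx β z + (pdx α z - pdy β z) * p z + pdy α z * p z ^ 2 +
        α z * pdx p z + β z * pdy p z) / (β z - α z * p z) ^ 2 := by
  have ha := (hα.differentiableAt (hU.mem_nhds hz)).hasFDerivAt
  have hb := (hβ.differentiableAt (hU.mem_nhds hz)).hasFDerivAt
  have hq := (hp.differentiableAt (hU.mem_nhds hz)).hasFDerivAt
  have hinv := (hasDerivAt_inv hf).comp_hasFDerivAt z (hb.fun_sub (ha.fun_mul hq))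
  have hx : HasFDerivAt (fun w => 1 / (β w - α w * p w)) _ z :=
    hinv.congr_of_eventuallyEq (.of_forall fun w => one_div _)
  have hy : HasFDerivAt (fun w => p w / (β w - α w * p w)) _ z :=
    (hq.fun_mul hinv).congr_of_eventuallyEq (.of_forall fun w => div_eq_mul_inv _ _)
  simp only [pdx, pdy, hx.fderiv, hy.fderiv, Function.comp_apply, add_apply,
    sub_apply, smul_apply, smul_eq_mul]
  field_simp
  ring
end

section
/- (Theorem 1, Lie's integrating-factor equivalence for a planar d-web.) Let U ⊆ ℂ × ℂ be open, let α, β : U → ℂ and p₁, …, p_d : U → ℂ (d ≥ 1) be differentiable, and assume the transversality condition that fᵢ := β − α·pᵢ is nonvanishing on U for every i. Then the following are equivalent: (i) for every i ∈ {1,…,d}, the symmetry equation −∂xβ + (∂xα − ∂yβ)·pᵢ + ∂yα·pᵢ² + α·∂xpᵢ + β·∂ypᵢ = 0 holds on U; (ii) for every i ∈ {1,…,d}, the 1-form (dy − pᵢ dx)/fᵢ is closed on U, i.e. ∂x(1/fᵢ) + ∂y(pᵢ/fᵢ) = 0 on U (that is, 1/fᵢ is an integrating factor for dy − pᵢ dx).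 -/
/-- The quotient rule for the Fréchet derivative evaluated in a direction. -/
theorem fderiv_div_apply_eq {g f : ℂ × ℂ → ℂ} {z : ℂ × ℂ} (hg : DifferentiableAt ℂ g z)
    (hf : DifferentiableAt ℂ f z) (h0 : f z ≠ 0) (v : ℂ × ℂ) :
    fderiv ℂ (fun w => g w / f w) z v =
      (f z * fderiv ℂ g z v - g z * fderiv ℂ f z v) / f z ^ 2 := by
  have hinv : HasFDerivAt (fun w => (f w)⁻¹) (-(f z ^ 2)⁻¹ • fderiv ℂ f z) z :=
    (hasDerivAt_inv h0).comp_hasFDerivAt z hf.hasFDerivAt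
  have h := (hg.hasFDerivAt.mul hinv).fderiv
  simp only [div_eq_mul_inv]
  change fderiv ℂ (g * fun w => (f w)⁻¹) z v = _
  rw [h]
  simp only [add_apply, smul_apply, smul_eq_mul]
  field_simp
  ring

/-- The derivative of `β - α p` in a direction. -/
theorem fderiv_sub_mul_apply {α β p : ℂ × ℂ → ℂ} {z : ℂ × ℂ} (hα : DifferentiableAt ℂ α z)
    (hβ : DifferentiableAt ℂ β z) (hp : DifferentiableAt ℂ p z) (v : ℂ × ℂ) :
    fderiv ℂ (fun w => β w - α w * p w) z v =
      fderiv ℂ β z v - (α z * fderiv ℂ p z v + p z * fderiv ℂ α z v) := by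
  have h := (hβ.hasFDerivAt.sub (hα.hasFDerivAt.mul hp.hasFDerivAt)).fderiv
  change fderiv ℂ (β - α * p) z v = _
  rw [h]
  simp

/-- The exterior derivative of `(dy - p dx) / (β - α p)` is the symmetry expression divided by
`(β - α p) ^ 2`. -/
theorem pdx_add_pdy_div_eq {α β p : ℂ × ℂ → ℂ} {z : ℂ × ℂ} (hα : DifferentiableAt ℂ α z)
    (hβ : DifferentiableAt ℂ β z) (hp : DifferentiableAt ℂ p z) (h0 : β z - α z * p z ≠ 0) :
    pdx (fun w => 1 / (β w - α w * p w)) z + pdy (fun w => p w / (β w - α w * p w)) z =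
      (-pdx β z + (pdx α z - pdy β z) * p z + pdy α z * p z ^ 2 +
        α z * pdx p z + β z * pdy p z) / (β z - α z * p z) ^ 2 := by
  have hf : DifferentiableAt ℂ (fun w => β w - α w * p w) z := hβ.sub (hα.mul hp)
  unfold pdx pdy
  rw [fderiv_div_apply_eq (g := fun _ => 1) (differentiableAt_const _) hf h0,
    fderiv_div_apply_eq hp hf h0, fderiv_sub_mul_apply hα hβ hp, fderiv_sub_mul_apply hα hβ hp,
    ← add_div]
  congr 1
  simp
  ring

/-- Theorem 1 (Lie's integrating-factor equivalence for a planar d-web).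
For a `d`-web with slopes `p i` and a vector field `X = α∂x + β∂y` transverse
to the web, `X` satisfies the symmetry equation for every slope `p i` iff
`1/(β - α·p i)` is an integrating factor for `dy - p i dx` for every `i`,
i.e. the 1-form `(dy - p i dx)/(β - α·p i)` is closed. -/
theorem lie_integrating_factor_equivalence
    (U : Set (ℂ × ℂ)) (hU : IsOpen U)
    (d : ℕ) (hd : 1 ≤ d)
    (α β : ℂ × ℂ → ℂ) (p : Fin d → ℂ × ℂ → ℂ)
    (hα : DifferentiableOn ℂ α U) (hβ : DifferentiableOn ℂ β U)
    (hp : ∀ i, DifferentiableOn ℂ (p i) U)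
    (htrans : ∀ i, ∀ z ∈ U, β z - α z * p i z ≠ 0) :
    (∀ i, ∀ z ∈ U,
        -pdx β z + (pdx α z - pdy β z) * p i z + pdy α z * p i z ^ 2 +
          α z * pdx (p i) z + β z * pdy (p i) z = 0) ↔
    (∀ i, ∀ z ∈ U,
        pdx (fun w => 1 / (β w - α w * p i w)) z +
          pdy (fun w => p i w / (β w - α w * p i w)) z = 0) := by
  refine forall_congr' fun i => forall₂_congr fun z hz => ?_
  have hU' := hU.mem_nhds hz
  rw [pdx_add_pdy_div_eq (hα.differentiableAt hU') (hβ.differentiableAt hU')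
    ((hp i).differentiableAt hU') (htrans i z hz), div_eq_zero_iff,
    or_iff_left (pow_ne_zero 2 (htrans i z hz))]
end

section
/- (Proposition 2, invariance of the discriminant.) Let U ⊆ ℂ × ℂ be open, let d ≥ 1, let a₀ : U → ℂ be differentiable and nonvanishing, let p₁, …, p_d : U → ℂ be differentiable, and let α, β : U → ℂ be differentiable functions such that (α,β) satisfies the symmetry equation with respect to each slope function pᵢ. Define Δ := a₀^{2d−2} · ∏_{1 ≤ i < j ≤ d} (pᵢ − pⱼ)². Then α·∂xΔ + β·∂yΔ = λ·Δ on U, where λ := (d−1)·( 2(α·∂xa₀ + β·∂ya₀)/a₀ − d·(∂xα − ∂yβ) − 2·∂yα·(p₁ + ⋯ + p_d) ). (If a₁ := −a₀(p₁ + ⋯ + p_d) denotes the second coefficient of F = a₀∏ᵢ(p − pᵢ), this is the formula λ_X = (d−1)(2X(a₀)/a₀ − d(∂xα − ∂yβ) + 2∂yα·a₁/a₀).) -/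
/-- If each `f i` is an eigenfunction at `z` of the derivation along `v`, then so is their product,
the eigenvalues being added. -/
theorem fderiv_finset_prod_eigen {ι : Type*} {z v : ℂ × ℂ} (s : Finset ι)
    (f : ι → ℂ × ℂ → ℂ) (c : ι → ℂ)
    (h : ∀ i ∈ s, DifferentiableAt ℂ (f i) z ∧ fderiv ℂ (f i) z v = c i * f i z) :
    DifferentiableAt ℂ (fun w => ∏ i ∈ s, f i w) z ∧
      fderiv ℂ (fun w => ∏ i ∈ s, f i w) z v = (∑ i ∈ s, c i) * ∏ i ∈ s, f i z := by
  classical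
  induction s using Finset.induction_on with
  | empty => simp
  | insert a s ha ih =>
    obtain ⟨hs, hs'⟩ := ih fun i hi => h i (Finset.mem_insert_of_mem hi)
    obtain ⟨hfa, hfa'⟩ := h a (Finset.mem_insert_self a s)
    simp only [Finset.prod_insert ha, Finset.sum_insert ha]
    refine ⟨hfa.mul hs, ?_⟩
    rw [fderiv_fun_mul hfa hs]
    simp only [add_apply, smul_apply, smul_eq_mul, hs', hfa']
    ring

/-- A power of an eigenfunction of the derivation along `v` is an eigenfunction. -/
theorem fderiv_pow_eigen {z v : ℂ × ℂ} {f : ℂ × ℂ → ℂ} {c : ℂ} (n : ℕ)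
    (hf : DifferentiableAt ℂ f z) (h : fderiv ℂ f z v = c * f z) :
    DifferentiableAt ℂ (fun w => f w ^ n) z ∧
      fderiv ℂ (fun w => f w ^ n) z v = (n * c) * f z ^ n := by
  simpa using fderiv_finset_prod_eigen (Finset.range n) (fun _ => f) (fun _ => c)
    fun _ _ => ⟨hf, h⟩

/-- The derivative of `f` along `(a, b)` in terms of partial derivatives. -/
theorem fderiv_apply_eq_pdx_add_pdy (f : ℂ × ℂ → ℂ) (z : ℂ × ℂ) (a b : ℂ) :
    fderiv ℂ f z (a, b) = a * pdx f z + b * pdy f z := by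
  have h : ((a, b) : ℂ × ℂ) = a • (1, 0) + b • (0, 1) := by simp
  rw [h, map_add, map_smul, map_smul]
  rfl

/-- Each index occurs in exactly `d - 1` of the pairs `i < j` of `Fin d`. -/
theorem sum_sum_Ioi_add {d : ℕ} (g : Fin d → ℂ) :
    ∑ i : Fin d, ∑ j ∈ Finset.Ioi i, (g i + g j) = ((d : ℂ) - 1) * ∑ i, g i := by
  have hswap : ∑ i : Fin d, ∑ j ∈ Finset.Ioi i, g j = ∑ j : Fin d, ∑ _i ∈ Finset.Iio j, g j :=
    Finset.sum_comm' (by simp)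
  simp only [Finset.sum_add_distrib]
  rw [hswap, ← Finset.sum_add_distrib, Finset.mul_sum]
  refine Finset.sum_congr rfl fun i _ => ?_
  have hcard : ((d - 1 - (i : ℕ) : ℕ) : ℂ) + (i : ℕ) = (d : ℂ) - 1 := by
    have hi := i.isLt
    rw [← Nat.cast_add, Nat.sub_add_cancel (by lia), Nat.cast_sub (by lia), Nat.cast_one]
  simp only [Finset.sum_const, Fin.card_Ioi, Fin.card_Iio, nsmul_eq_mul]
  rw [← add_mul, hcard]

/-- Proposition 2 (invariance of the discriminant).  If `(α,β)` satisfies the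
symmetry equation with respect to every slope `p i` of a `d`-web, then the
`p`-discriminant `Δ = a₀^{2d−2} ∏_{i<j} (p i − p j)²` satisfies
`X(Δ) = λ·Δ` with
`λ = (d−1)(2X(a₀)/a₀ − d(∂xα − ∂yβ) − 2∂yα·Σᵢ p i)`. -/
theorem discriminant_invariance
    (U : Set (ℂ × ℂ)) (hU : IsOpen U)
    (d : ℕ) (hd : 1 ≤ d)
    (a₀ : ℂ × ℂ → ℂ) (ha₀ : DifferentiableOn ℂ a₀ U)
    (ha₀ne : ∀ z ∈ U, a₀ z ≠ 0)
    (p : Fin d → ℂ × ℂ → ℂ) (hp : ∀ i, DifferentiableOn ℂ (p i) U)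
    (α β : ℂ × ℂ → ℂ)
    (hα : DifferentiableOn ℂ α U) (hβ : DifferentiableOn ℂ β U)
    (hsym : ∀ i, ∀ z ∈ U,
        -pdx β z + (pdx α z - pdy β z) * p i z + pdy α z * p i z ^ 2 +
          α z * pdx (p i) z + β z * pdy (p i) z = 0)
    (Δ : ℂ × ℂ → ℂ)
    (hΔ : ∀ z, Δ z = a₀ z ^ (2 * d - 2) *
        ∏ i : Fin d, ∏ j ∈ Finset.Ioi i, (p i z - p j z) ^ 2) :
    ∀ z ∈ U,
      α z * pdx Δ z + β z * pdy Δ z =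
        ((d : ℂ) - 1) *
          (2 * (α z * pdx a₀ z + β z * pdy a₀ z) / a₀ z -
            (d : ℂ) * (pdx α z - pdy β z) -
            2 * pdy α z * ∑ i : Fin d, p i z) * Δ z := by
  intro z hz
  have hUz := hU.mem_nhds hz
  have hp' i : DifferentiableAt ℂ (p i) z := (hp i).differentiableAt hUz
  let v : ℂ × ℂ := (α z, β z)
  let g : Fin d → ℂ := fun i => -(pdx α z - pdy β z) - 2 * pdy α z * p i z
  have hdiff i j : DifferentiableAt ℂ (fun w => p i w - p j w) z ∧
      fderiv ℂ (fun w => p i w - p j w) z v = ((g i + g j) / 2) * (p i z - p j z) := by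
    refine ⟨(hp' i).sub (hp' j), ?_⟩
    rw [fderiv_fun_sub (hp' i) (hp' j), sub_apply,
      fderiv_apply_eq_pdx_add_pdy, fderiv_apply_eq_pdx_add_pdy]
    simp only [g]
    linear_combination hsym i z hz - hsym j z hz
  have hprod := fderiv_finset_prod_eigen Finset.univ _ _ fun i _ =>
    fderiv_finset_prod_eigen (Finset.Ioi i) _ _ fun j _ =>
      fderiv_pow_eigen 2 (hdiff i j).1 (hdiff i j).2
  have hlead : fderiv ℂ a₀ z v = (fderiv ℂ a₀ z v / a₀ z) * a₀ z :=
    (div_mul_cancel₀ _ (ha₀ne z hz)).symm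
  have hpow := fderiv_pow_eigen (2 * d - 2) (ha₀.differentiableAt hUz) hlead
  have hsum : ∑ i : Fin d, ∑ j ∈ Finset.Ioi i, ((2 : ℕ) : ℂ) * ((g i + g j) / 2) =
      ((d : ℂ) - 1) * (-(d : ℂ) * (pdx α z - pdy β z) - 2 * pdy α z * ∑ i, p i z) := by
    simp only [Nat.cast_ofNat, mul_div_cancel₀ _ (two_ne_zero' ℂ)]
    rw [sum_sum_Ioi_add]
    simp only [g, Finset.sum_sub_distrib, ← Finset.mul_sum, Finset.sum_const, Finset.card_univ,
      Fintype.card_fin, nsmul_eq_mul]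
    ring
  have hcast : ((2 * d - 2 : ℕ) : ℂ) = 2 * ((d : ℂ) - 1) := by
    rw [Nat.cast_sub (by lia)]
    push_cast
    ring
  rw [← fderiv_apply_eq_pdx_add_pdy, ← fderiv_apply_eq_pdx_add_pdy, funext hΔ,
    fderiv_fun_mul hpow.1 hprod.1]
  simp only [add_apply, smul_apply, smul_eq_mul]
  rw [hpow.2, hprod.2, hsum, hcast]
  ring
end

section
/- (Proposition 2, divisibility of the irreducible components.) Let R be a commutative integral domain which is a unique factorization domain and a ℚ-algebra, and let D : R → R be a derivation (additive and satisfying D(ab) = a·D(b) + b·D(a)). Let Δ = Δ₁^{m₁} ⋯ Δ_r^{m_r}, where Δ₁, …, Δ_r are pairwise non-associated prime elements of R and each m_q ≥ 1. If D(Δ) = λ·Δ for some λ ∈ R, then for each q ∈ {1,…,r} there exists λ_q ∈ R with D(Δ_q) = λ_q·Δ_q, i.e. each Δ_q divides D(Δ_q). -/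
/-- The power rule for a map satisfying the Leibniz rule. -/
theorem leibniz_pow_succ {R : Type*} [CommRing R] {D : R → R}
    (hmul : ∀ a b : R, D (a * b) = a * D b + b * D a) (a : R) (n : ℕ) :
    D (a ^ (n + 1)) = ((n + 1 : ℕ) : R) * a ^ n * D a := by
  induction n with
  | zero => simp
  | succ n ih =>
    rw [pow_succ, hmul, ih]
    push_cast
    ring

/-- If `p` is prime, `p ∤ c` and `p ^ (n + 1) * c` divides its own derivative, then `p ∣ D p`. -/
theorem Prime.dvd_leibniz_of_pow_mul_dvd {R : Type*} [CommRing R] [IsDomain R] [Algebra ℚ R]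
    {D : R → R} (hmul : ∀ a b : R, D (a * b) = a * D b + b * D a) {p c : R} (hp : Prime p)
    (hc : ¬ p ∣ c) {n : ℕ} (h : p ^ (n + 1) * c ∣ D (p ^ (n + 1) * c)) : p ∣ D p := by
  obtain ⟨l, hl⟩ := h
  rw [hmul, leibniz_pow_succ hmul] at hl
  have key : c * (((n + 1 : ℕ) : R) * D p) = p * (c * l - D c) := by
    apply mul_left_cancel₀ (pow_ne_zero n hp.ne_zero)
    linear_combination hl
  have hunit : IsUnit ((n + 1 : ℕ) : R) := by
    have hq : IsUnit ((n + 1 : ℕ) : ℚ) := (Nat.cast_ne_zero.mpr n.succ_ne_zero).isUnit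
    simpa only [map_natCast] using hq.map (algebraMap ℚ R)
  exact hunit.dvd_mul_left.mp ((hp.dvd_or_dvd ⟨_, key⟩).resolve_left hc)

/-- Proposition 2 (divisibility of the irreducible components).  Let `R` be a
UFD which is a `ℚ`-algebra and `D : R → R` a derivation.  If
`Δ = Δ₁^{m₁} ⋯ Δ_r^{m_r}` with the `Δ_q` pairwise non-associated primes and
`D(Δ) = λ·Δ`, then each `Δ_q` divides `D(Δ_q)`. -/
theorem derivation_divides_each_prime_component
    (R : Type*) [CommRing R] [IsDomain R] [UniqueFactorizationMonoid R]
    [Algebra ℚ R]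
    (D : R → R)
    (hadd : ∀ a b : R, D (a + b) = D a + D b)
    (hmul : ∀ a b : R, D (a * b) = a * D b + b * D a)
    (r : ℕ) (Δ : Fin r → R) (m : Fin r → ℕ)
    (hprime : ∀ q, Prime (Δ q))
    (hassoc : ∀ q q', q ≠ q' → ¬ Associated (Δ q) (Δ q'))
    (hm : ∀ q, 1 ≤ m q)
    (lam : R)
    (hD : D (∏ q, Δ q ^ m q) = lam * ∏ q, Δ q ^ m q) :
    ∀ q, ∃ lamq : R, D (Δ q) = lamq * Δ q := by
  intro q
  have hc : ¬ Δ q ∣ ∏ i ∈ Finset.univ.erase q, Δ i ^ m i := by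
    rw [(hprime q).dvd_finsetProd_iff]
    rintro ⟨i, hi, hdvd⟩
    exact hassoc q i (Finset.ne_of_mem_erase hi).symm
      ((hprime q).associated_of_dvd (hprime i) ((hprime q).dvd_of_dvd_pow hdvd))
  obtain ⟨n, hn⟩ := Nat.exists_eq_add_of_le' (hm q)
  rw [← Finset.mul_prod_erase Finset.univ (fun i => Δ i ^ m i) (Finset.mem_univ q), hn] at hD
  obtain ⟨l, hl⟩ :=
    (hprime q).dvd_leibniz_of_pow_mul_dvd hmul hc (Dvd.intro_left lam hD.symm)
  exact ⟨l, hl.trans (mul_comm _ _)⟩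
end

section
/- (Evaluation of the Bezout pair at a root gives the implicit derivative.) Let U ⊆ ℂ × ℂ be open, d ≥ 1, and let a₀, …, a_d : U → ℂ be differentiable. Set F(x,y,p) := Σ_{j=0}^{d} a_j(x,y)·p^{d−j}, ∂_pF(x,y,p) := Σ_{j=0}^{d−1} (d−j)·a_j(x,y)·p^{d−j−1}, and ∂_xF(x,y,p) := Σ_{j=0}^{d} ∂x(a_j)(x,y)·p^{d−j}. Suppose V(x,y,p) and G(x,y,p) are polynomials in p with function coefficients on U such that V·F − G·∂_pF = ∂_xF as polynomials in p at every point of U. Let p₀ : U → ℂ be differentiable with F(x,y,p₀(x,y)) = 0 and ∂_pF(x,y,p₀(x,y)) ≠ 0 on U. Then G(x,y,p₀(x,y)) = ∂x p₀(x,y) for all (x,y) ∈ U. -/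
/-- Evaluation of the Bezout pair at a root gives the implicit derivative:
if `V·F − G·∂_pF = ∂_xF` as polynomials in `p` at every point of `U`, and
`p₀` is a differentiable simple root of `F`, then `G(x,y,p₀) = ∂x p₀`. -/
theorem bezout_pair_eval_at_root
    (U : Set (ℂ × ℂ)) (hU : IsOpen U)
    (d : ℕ) (hd : 1 ≤ d)
    (a : Fin (d + 1) → ℂ × ℂ → ℂ)
    (ha : ∀ j, DifferentiableOn ℂ (a j) U)
    (F Fp Fx : ℂ × ℂ → ℂ → ℂ)
    (hF : ∀ z q, F z q = ∑ j : Fin (d + 1), a j z * q ^ (d - (j : ℕ)))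
    (hFp : ∀ z q, Fp z q =
      ∑ j : Fin (d + 1), ((d : ℂ) - (j : ℕ)) * a j z * q ^ (d - (j : ℕ) - 1))
    (hFx : ∀ z q, Fx z q = ∑ j : Fin (d + 1), pdx (a j) z * q ^ (d - (j : ℕ)))
    (V G : ℂ × ℂ → Polynomial ℂ)
    (hVG : ∀ z ∈ U, ∀ q : ℂ,
      (V z).eval q * F z q - (G z).eval q * Fp z q = Fx z q)
    (p₀ : ℂ × ℂ → ℂ) (hp₀ : DifferentiableOn ℂ p₀ U)
    (hroot : ∀ z ∈ U, F z (p₀ z) = 0)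
    (hsimple : ∀ z ∈ U, Fp z (p₀ z) ≠ 0) :
    ∀ z ∈ U, (G z).eval (p₀ z) = pdx p₀ z := by
  intro z hz
  have hUz : U ∈ nhds z := hU.mem_nhds hz
  have hp : HasFDerivAt p₀ (fderiv ℂ p₀ z) z := (hp₀.differentiableAt hUz).hasFDerivAt
  have hsum : HasFDerivAt (fun w => ∑ j : Fin (d + 1), a j w * p₀ w ^ (d - (j : ℕ))) _ z :=
    HasFDerivAt.fun_sum fun j _ =>
      ((ha j).differentiableAt hUz).hasFDerivAt.mul (hp.pow (d - (j : ℕ)))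
  have hzero : (fun w => ∑ j : Fin (d + 1), a j w * p₀ w ^ (d - (j : ℕ))) =ᶠ[nhds z]
      fun _ => (0 : ℂ) := by
    filter_upwards [hUz] with w hw
    rw [← hF, hroot w hw]
  have hderiv := DFunLike.congr_fun
    (hsum.unique ((hasFDerivAt_const (0 : ℂ) z).congr_of_eventuallyEq hzero)) (1, 0)
  have himplicit : Fx z (p₀ z) + Fp z (p₀ z) * pdx p₀ z = 0 := by
    rw [hFx, hFp, Finset.sum_mul, ← Finset.sum_add_distrib]
    simp only [sum_apply, zero_apply] at hderiv
    rw [← hderiv]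
    refine Finset.sum_congr rfl fun j _ => ?_
    have hj : (j : ℕ) ≤ d := Nat.lt_succ_iff.mp j.isLt
    simp [pdx, Nat.cast_sub hj]
    ring
  have hbezout := hVG z hz (p₀ z)
  rw [hroot z hz] at hbezout
  refine mul_right_cancel₀ (hsimple z hz) ?_
  linear_combination -hbezout - himplicit
end

section
/- (Trace relation for the connection of symmetries of a 3-web.) Let U ⊆ ℂ × ℂ be open and a₀, a₁, a₂, a₃ : U → ℂ differentiable, with a₀ and Δ := −4a₀a₂³ + 18a₀a₁a₂a₃ − 27a₀²a₃² + a₁²a₂² − 4a₁³a₃ nonvanishing on U. Suppose v₁, v₂, g₁, g₂, g₃ : U → ℂ satisfy a₀v₁ − 3a₀g₁ = 0, a₁v₁ + a₀v₂ − 2a₁g₁ − 3a₀g₂ = ∂x a₀, a₂v₁ + a₁v₂ − a₂g₁ − 2a₁g₂ − 3a₀g₃ = ∂x a₁, a₃v₁ + a₂v₂ − a₂g₂ − 2a₁g₃ = ∂x a₂, a₃v₂ − a₂g₃ = ∂x a₃, and that w₁, w₂, h₁, h₂, h₃ : U → ℂ satisfy the same five equations with ∂x replaced by ∂y. Define DA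 := a₃(2a₂² − 6a₁a₃)∂y a₀ + a₃(9a₀a₃ − a₁a₂)(∂x a₀ + ∂y a₁) + a₃(2a₁² − 6a₀a₂)(∂x a₁ + ∂y a₂) + (4a₀a₂² − a₁²a₂ − 3a₀a₁a₃)(∂x a₂ + ∂y a₃) + (18a₀²a₃ − 8a₀a₁a₂ + 2a₁³)∂x a₃ and DB := (18a₀a₃² − 8a₁a₂a₃ + 2a₂³)∂y a₀ + (4a₁²a₃ − a₁a₂² − 3a₀a₂a₃)(∂x a₀ + ∂y a₁) + a₀(2a₂² − 6a₁a₃)(∂x a₁ + ∂y a₂) + a₀(9a₀a₃ − a₁a₂)(∂x a₂ + ∂y a₃) + a₀(2a₁² − 6a₀a₂)∂x a₃. Then 2Δ·h₂ = 4Δ·g₁ + 4·DB + ∂yΔ and 4Δ·h₃ = 2Δ·g₂ + 4·DA + ∂xΔ on U (equivalently h₂ = 2g₁ + 2B + ∂yΔ/(2Δ) and h₃ = g₂/2 + A + ∂xΔ/(4Δ), where A = DA/Δ and B = DB/Δ). -/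
theorem fderiv_cubic_discriminant {E : Type*} [NormedAddCommGroup E] [NormedSpace ℂ E]
    {a b c d : E → ℂ} {z : E}
    (ha : DifferentiableAt ℂ a z) (hb : DifferentiableAt ℂ b z)
    (hc : DifferentiableAt ℂ c z) (hd : DifferentiableAt ℂ d z) (v : E) :
    fderiv ℂ (fun z => -4 * a z * c z ^ 3 + 18 * a z * b z * c z * d z
        - 27 * a z ^ 2 * d z ^ 2 + b z ^ 2 * c z ^ 2 - 4 * b z ^ 3 * d z) z v =
      (-4 * c z ^ 3 + 18 * b z * c z * d z - 54 * a z * d z ^ 2) * fderiv ℂ a z v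
      + (18 * a z * c z * d z + 2 * b z * c z ^ 2 - 12 * b z ^ 2 * d z) * fderiv ℂ b z v
      + (-12 * a z * c z ^ 2 + 18 * a z * b z * d z + 2 * b z ^ 2 * c z) * fderiv ℂ c z v
      + (18 * a z * b z * c z - 54 * a z ^ 2 * d z - 4 * b z ^ 3) * fderiv ℂ d z v := by
  have ha := ha.hasFDerivAt
  have hb := hb.hasFDerivAt
  have hc := hc.hasFDerivAt
  have hd := hd.hasFDerivAt
  have h := ((((((ha.const_mul (-4)).mul (hc.pow 3)).add
    ((((ha.const_mul 18).mul hb).mul hc).mul hd)).sub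
    (((ha.pow 2).const_mul 27).mul (hd.pow 2))).add
    ((hb.pow 2).mul (hc.pow 2))).sub
    (((hb.pow 3).const_mul 4).mul hd))
  refine (DFunLike.congr_fun (HasFDerivAt.fderiv h) v).trans ?_
  simp
  ring

/-- Trace relation for the connection of symmetries of a 3-web:
`h₂ = 2g₁ + 2B + ∂yΔ/(2Δ)` and `h₃ = g₂/2 + A + ∂xΔ/(4Δ)`, written in the
denominator-free form `2Δ·h₂ = 4Δ·g₁ + 4·DB + ∂yΔ` and
`4Δ·h₃ = 2Δ·g₂ + 4·DA + ∂xΔ`, where `DA = Δ·A` and `DB = Δ·B`. -/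
theorem trace_relation_three_web
    (U : Set (ℂ × ℂ)) (hU : IsOpen U)
    (a₀ a₁ a₂ a₃ : ℂ × ℂ → ℂ)
    (ha₀ : DifferentiableOn ℂ a₀ U) (ha₁ : DifferentiableOn ℂ a₁ U)
    (ha₂ : DifferentiableOn ℂ a₂ U) (ha₃ : DifferentiableOn ℂ a₃ U)
    (ha₀ne : ∀ z ∈ U, a₀ z ≠ 0)
    (Δ : ℂ × ℂ → ℂ)
    (hΔ : ∀ z, Δ z = -4 * a₀ z * a₂ z ^ 3 + 18 * a₀ z * a₁ z * a₂ z * a₃ z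
        - 27 * a₀ z ^ 2 * a₃ z ^ 2 + a₁ z ^ 2 * a₂ z ^ 2 - 4 * a₁ z ^ 3 * a₃ z)
    (hΔne : ∀ z ∈ U, Δ z ≠ 0)
    (v₁ v₂ g₁ g₂ g₃ : ℂ × ℂ → ℂ)
    (hg1 : ∀ z ∈ U, a₀ z * v₁ z - 3 * a₀ z * g₁ z = 0)
    (hg2 : ∀ z ∈ U, a₁ z * v₁ z + a₀ z * v₂ z - 2 * a₁ z * g₁ z
        - 3 * a₀ z * g₂ z = pdx a₀ z)
    (hg3 : ∀ z ∈ U, a₂ z * v₁ z + a₁ z * v₂ z - a₂ z * g₁ z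
        - 2 * a₁ z * g₂ z - 3 * a₀ z * g₃ z = pdx a₁ z)
    (hg4 : ∀ z ∈ U, a₃ z * v₁ z + a₂ z * v₂ z - a₂ z * g₂ z
        - 2 * a₁ z * g₃ z = pdx a₂ z)
    (hg5 : ∀ z ∈ U, a₃ z * v₂ z - a₂ z * g₃ z = pdx a₃ z)
    (w₁ w₂ h₁ h₂ h₃ : ℂ × ℂ → ℂ)
    (hh1 : ∀ z ∈ U, a₀ z * w₁ z - 3 * a₀ z * h₁ z = 0)
    (hh2 : ∀ z ∈ U, a₁ z * w₁ z + a₀ z * w₂ z - 2 * a₁ z * h₁ z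
        - 3 * a₀ z * h₂ z = pdy a₀ z)
    (hh3 : ∀ z ∈ U, a₂ z * w₁ z + a₁ z * w₂ z - a₂ z * h₁ z
        - 2 * a₁ z * h₂ z - 3 * a₀ z * h₃ z = pdy a₁ z)
    (hh4 : ∀ z ∈ U, a₃ z * w₁ z + a₂ z * w₂ z - a₂ z * h₂ z
        - 2 * a₁ z * h₃ z = pdy a₂ z)
    (hh5 : ∀ z ∈ U, a₃ z * w₂ z - a₂ z * h₃ z = pdy a₃ z)
    (DA DB : ℂ × ℂ → ℂ)
    (hDA : ∀ z, DA z =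
        a₃ z * (2 * a₂ z ^ 2 - 6 * a₁ z * a₃ z) * pdy a₀ z
        + a₃ z * (9 * a₀ z * a₃ z - a₁ z * a₂ z) * (pdx a₀ z + pdy a₁ z)
        + a₃ z * (2 * a₁ z ^ 2 - 6 * a₀ z * a₂ z) * (pdx a₁ z + pdy a₂ z)
        + (4 * a₀ z * a₂ z ^ 2 - a₁ z ^ 2 * a₂ z - 3 * a₀ z * a₁ z * a₃ z) *
            (pdx a₂ z + pdy a₃ z)
        + (18 * a₀ z ^ 2 * a₃ z - 8 * a₀ z * a₁ z * a₂ z + 2 * a₁ z ^ 3) *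
            pdx a₃ z)
    (hDB : ∀ z, DB z =
        (18 * a₀ z * a₃ z ^ 2 - 8 * a₁ z * a₂ z * a₃ z + 2 * a₂ z ^ 3) *
            pdy a₀ z
        + (4 * a₁ z ^ 2 * a₃ z - a₁ z * a₂ z ^ 2 - 3 * a₀ z * a₂ z * a₃ z) *
            (pdx a₀ z + pdy a₁ z)
        + a₀ z * (2 * a₂ z ^ 2 - 6 * a₁ z * a₃ z) * (pdx a₁ z + pdy a₂ z)
        + a₀ z * (9 * a₀ z * a₃ z - a₁ z * a₂ z) * (pdx a₂ z + pdy a₃ z)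
        + a₀ z * (2 * a₁ z ^ 2 - 6 * a₀ z * a₂ z) * pdx a₃ z) :
    ∀ z ∈ U,
      2 * Δ z * h₂ z = 4 * Δ z * g₁ z + 4 * DB z + pdy Δ z ∧
      4 * Δ z * h₃ z = 2 * Δ z * g₂ z + 4 * DA z + pdx Δ z := by
  intro z hz
  have hU' := hU.mem_nhds hz
  have hD := fderiv_cubic_discriminant (ha₀.differentiableAt hU') (ha₁.differentiableAt hU')
    (ha₂.differentiableAt hU') (ha₃.differentiableAt hU')
  rw [← funext hΔ] at hD
  have hv : v₁ z = 3 * g₁ z :=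
    mul_left_cancel₀ (ha₀ne z hz) (by linear_combination hg1 z hz)
  have hw : w₁ z = 3 * h₁ z :=
    mul_left_cancel₀ (ha₀ne z hz) (by linear_combination hh1 z hz)
  have hx : pdx Δ z = _ := hD (1, 0)
  have hy : pdy Δ z = _ := hD (0, 1)
  simp only [← pdx.eq_def, ← pdy.eq_def] at hx hy
  rw [hDA, hDB, hx, hy, hΔ, ← hg2 z hz, ← hg3 z hz, ← hg4 z hz, ← hg5 z hz,
    ← hh2 z hz, ← hh3 z hz, ← hh4 z hz, ← hh5 z hz, hv, hw]
  constructor <;> ring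
end

section
/- (Proposition 3, identities for the first WDVV booklet 3-web W₁.) Let U ⊆ ℂ × ℂ be open and f : U → ℂ holomorphic. With f_{xxx}, f_{xxy}, f_{xyy}, f_{yyy} denoting the third-order partial derivatives of f, set a₀ := f_{xyy}, a₁ := 2f_{xxy}, a₂ := f_{xxx}, a₃ := −1, E₁ := f_{yyy} + f_{xxx}·f_{xyy} − f_{xxy}², Δ := −4a₀a₂³ + 18a₀a₁a₂a₃ − 27a₀²a₃² + a₁²a₂² − 4a₁³a₃, DA := a₃(2a₂² − 6a₁a₃)∂y a₀ + a₃(9a₀a₃ − a₁a₂)(∂x a₀ + ∂y a₁) + a₃(2a₁² − 6a₀a₂)(∂x a₁ + ∂y a₂) + (4a₀a₂² − a₁²a₂ − 3a₀a₁a₃)(∂x a₂ + ∂y a₃) + (18a₀²a₃ − 8a₀a₁a₂ + 2a₁³)∂x a₃, and DB := (18a₀a₃² − 8a₁a₂a₃ + 2a₂³)∂y a₀ + (4a₁²a₃ − a₁a₂² − 3a₀a₂a₃)(∂x a₀ + ∂y a₁) + a₀(2a₂² − 6a₁a₃)(∂x a₁ + ∂y a₂) + a₀(9a₀a₃ − a₁a₂)(∂x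 a₂ + ∂y a₃) + a₀(2a₁² − 6a₀a₂)∂x a₃. Then on U: 2·DA + ∂xΔ = −4·∂x(E₁)·(6f_{xxy} + f_{xxx}²) and 2·DB + ∂yΔ = −2·∂x(E₁)·(9f_{xyy} + 2f_{xxx}·f_{xxy}). -/
open Metric MeasureTheory Filter Topology in
/-- Directional derivatives of a holomorphic function on an open subset of a finite-dimensional
space are holomorphic. -/
theorem differentiableOn_fderiv_apply_const {E : Type*} [NormedAddCommGroup E] [NormedSpace ℂ E]
    [FiniteDimensional ℂ E] {U : Set E} {f : E → ℂ} (hf : DifferentiableOn ℂ f U)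
    (hU : IsOpen U) (v : E) : DifferentiableOn ℂ (fun z => fderiv ℂ f z v) U := by
  intro z₀ hz₀
  refine DifferentiableAt.differentiableWithinAt ?_
  borelize E
  have : CompleteSpace E := FiniteDimensional.complete ℂ E
  obtain ⟨ε, hε, hball⟩ : ∃ ε > 0, ∀ z ∈ ball z₀ ε, z ∈ U ∧ dist (f z) (f z₀) < 1 := by
    have hcont := (hf.differentiableAt (hU.mem_nhds hz₀)).continuousAt
    exact Metric.eventually_nhds_iff_ball.1
      ((hU.eventually_mem hz₀).and (hcont.eventually (ball_mem_nhds _ one_pos)))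
  have hdiff : ∀ z ∈ ball z₀ ε, DifferentiableAt ℂ f z := fun z hz =>
    hf.differentiableAt (hU.mem_nhds (hball z hz).1)
  have hbound : ∀ w ∈ ball z₀ (ε / 2), ‖fderiv ℂ f w‖ ≤ 2 / (ε / 2) := by
    intro w hw
    have hsub : ball w (ε / 2) ⊆ ball z₀ ε := ball_subset_ball' (by
      have := mem_ball.1 hw
      linarith)
    refine Complex.norm_fderiv_le_div_of_mapsTo_ball
      (fun z hz => (hdiff z (hsub hz)).differentiableWithinAt) (fun z hz => ?_) (by positivity)
    have h₁ := (hball z (hsub hz)).2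
    have h₂ := (hball w (hsub (mem_ball_self (by positivity)))).2
    have := dist_triangle_right (f z) (f w) (f z₀)
    exact mem_closedBall.2 (by linarith)
  obtain ⟨ρ, hρ, hρv⟩ : ∃ ρ > 0, ρ * ‖v‖ < ε / 4 := by
    refine ⟨ε / 4 / (‖v‖ + 1), by positivity, ?_⟩
    rw [div_mul_eq_mul_div, div_lt_iff₀ (by positivity)]
    nlinarith
  have hmem : ∀ z ∈ ball z₀ (ε / 4), ∀ t ∈ closedBall (0 : ℂ) ρ, z + t • v ∈ ball z₀ (ε / 2) := by
    intro z hz t ht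
    have h₁ := mem_ball.1 hz
    have h₂ : ‖t • v‖ ≤ ρ * ‖v‖ := by
      rw [norm_smul]
      exact mul_le_mul_of_nonneg_right (mem_closedBall_zero_iff.1 ht) (norm_nonneg v)
    have h₃ := norm_add_le (z - z₀) (t • v)
    rw [mem_ball, dist_eq_norm] at *
    rw [show z + t • v - z₀ = z - z₀ + t • v by abel]
    linarith
  have hmem' : ∀ z ∈ ball z₀ (ε / 4), ∀ t ∈ closedBall (0 : ℂ) ρ, z + t • v ∈ ball z₀ ε :=
    fun z hz t ht => ball_subset_ball (by linarith) (hmem z hz t ht)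
  have hcircle : ∀ θ, circleMap 0 ρ θ ∈ closedBall (0 : ℂ) ρ := circleMap_mem_closedBall 0 hρ.le
  set c : ℝ → ℂ := fun θ => deriv (circleMap 0 ρ) θ * ((circleMap 0 ρ θ - 0) ^ 2)⁻¹ with hc
  have hc_cont : Continuous c := by
    simp only [hc, deriv_circleMap]
    refine Continuous.mul (by fun_prop) (Continuous.inv₀ (by fun_prop) fun θ => ?_)
    simpa using hρ.ne'
  have hF_cont : ∀ z ∈ ball z₀ (ε / 4),
      Continuous fun θ : ℝ => c θ • f (z + circleMap 0 ρ θ • v) := by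
    intro z hz
    refine hc_cont.smul (continuous_iff_continuousAt.2 fun θ => ?_)
    exact ContinuousAt.comp (f := fun θ : ℝ => z + circleMap 0 ρ θ • v)
      (hdiff _ (hmem' z hz _ (hcircle θ))).continuousAt (by fun_prop)
  have hz₀_mem : z₀ ∈ ball z₀ (ε / 4) := mem_ball_self (by positivity)
  have key := intervalIntegral.hasFDerivAt_integral_of_dominated_of_fderiv_le
    (𝕜 := ℂ) (μ := volume) (a := 0) (b := 2 * Real.pi)
    (F := fun z θ => c θ • f (z + circleMap 0 ρ θ • v))
    (F' := fun z θ => c θ • fderiv ℂ f (z + circleMap 0 ρ θ • v))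
    (bound := fun θ => ‖c θ‖ * (2 / (ε / 2)))
    (ball_mem_nhds z₀ (by positivity : 0 < ε / 4))
    (by filter_upwards [ball_mem_nhds z₀ (by positivity : 0 < ε / 4)] with z hz
          using (hF_cont z hz).aestronglyMeasurable)
    ((hF_cont z₀ hz₀_mem).intervalIntegrable _ _)
    (hc_cont.aestronglyMeasurable.smul
      ((measurable_fderiv ℂ f).comp (by fun_prop : Continuous fun θ : ℝ =>
        z₀ + circleMap 0 ρ θ • v).measurable).aestronglyMeasurable)
    (.of_forall fun θ _ z hz => by
      rw [norm_smul]
      exact mul_le_mul_of_nonneg_left (hbound _ (hmem z hz _ (hcircle θ))) (norm_nonneg _))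
    ((by fun_prop : Continuous fun θ => ‖c θ‖ * (2 / (ε / 2))).intervalIntegrable _ _)
    (.of_forall fun θ _ z hz => by
      have h := (hdiff _ (hmem' z hz _ (hcircle θ))).hasFDerivAt
      exact ((hasFDerivAt_comp_add_right _).2 h).const_smul (c θ))
  refine (key.differentiableAt.const_smul (2 * Real.pi * Complex.I : ℂ)⁻¹).congr_of_eventuallyEq ?_
  filter_upwards [ball_mem_nhds z₀ (by positivity : 0 < ε / 4)] with z hz
  have hline : ∀ t : ℂ, HasDerivAt (fun t : ℂ => z + t • v) v t := fun t => by
    simpa using ((hasDerivAt_id t).smul_const v).const_add z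
  have hcauchy := Complex.cderiv_eq_deriv (r := ρ) (z := 0) (f := fun t : ℂ => f (z + t • v))
    (U := (fun t : ℂ => z + t • v) ⁻¹' ball z₀ ε)
    (isOpen_ball.preimage (by fun_prop))
    (fun t ht => ((hdiff _ ht).comp t (hline t).differentiableAt).differentiableWithinAt)
    hρ (fun t ht => hmem' z hz t ht)
  have hderiv : deriv (fun t : ℂ => f (z + t • v)) 0 = fderiv ℂ f z v := by
    have h := (hdiff (z + (0 : ℂ) • v)
      (hmem' z hz 0 (mem_closedBall_self hρ.le))).hasFDerivAt.comp_hasDerivAt 0 (hline 0)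
    simpa [Function.comp_def] using h.deriv
  rw [← hderiv, ← hcauchy]
  simp only [Complex.cderiv, circleIntegral, hc, smul_eq_mul, mul_assoc, Pi.smul_apply]

section PartialDerivatives

variable {U : Set (ℂ × ℂ)} {f g : ℂ × ℂ → ℂ}

theorem differentiableOn_pdx (hf : DifferentiableOn ℂ f U) (hU : IsOpen U) :
    DifferentiableOn ℂ (pdx f) U :=
  differentiableOn_fderiv_apply_const hf hU (1, 0)

theorem differentiableOn_pdy (hf : DifferentiableOn ℂ f U) (hU : IsOpen U) :
    DifferentiableOn ℂ (pdy f) U :=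
  differentiableOn_fderiv_apply_const hf hU (0, 1)

theorem pdy_congr_of_eqOn (hU : IsOpen U) (h : Set.EqOn f g U) : Set.EqOn (pdy f) (pdy g) U :=
  fun z hz => by simp only [pdy, (h.eventuallyEq_of_mem (hU.mem_nhds hz)).fderiv_eq]

theorem pdx_pdy_comm (hf : DifferentiableOn ℂ f U) (hU : IsOpen U) :
    Set.EqOn (pdx (pdy f)) (pdy (pdx f)) U := by
  intro z hz
  have hx := (differentiableOn_pdx hf hU).differentiableAt (hU.mem_nhds hz)
  have hy := (differentiableOn_pdy hf hU).differentiableAt (hU.mem_nhds hz)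
  have hsplit : fderiv ℂ f = fun w =>
      pdx f w • ContinuousLinearMap.fst ℂ ℂ ℂ + pdy f w • ContinuousLinearMap.snd ℂ ℂ ℂ := by
    funext w
    ext <;> simp [pdx, pdy]
  have hd : DifferentiableAt ℂ (fderiv ℂ f) z := by
    rw [hsplit]
    exact (hx.smul_const _).add (hy.smul_const _)
  have hsymm := second_derivative_symmetric_of_eventually
    (by filter_upwards [hU.mem_nhds hz] with w hw
          using (hf.differentiableAt (hU.mem_nhds hw)).hasFDerivAt)
    hd.hasFDerivAt (1, 0) (0, 1)
  have happly : ∀ u v, fderiv ℂ (fun w => fderiv ℂ f w v) z u = fderiv ℂ (fderiv ℂ f) z u v :=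
    fun u v => by simp [fderiv_clm_apply hd (differentiableAt_const v)]
  exact (happly _ _).trans (hsymm.trans (happly _ _).symm)

end PartialDerivatives

/-- Proposition 3, identities for the first WDVV booklet 3-web `W₁`:
`2·DA + ∂xΔ = −4∂x(E₁)(6f_{xxy} + f_{xxx}²)` and
`2·DB + ∂yΔ = −2∂x(E₁)(9f_{xyy} + 2f_{xxx}f_{xxy})`. -/
theorem wdvv_booklet_W1_identities
    (U : Set (ℂ × ℂ)) (hU : IsOpen U)
    (f : ℂ × ℂ → ℂ) (hf : DifferentiableOn ℂ f U)
    (fxxx fxxy fxyy fyyy : ℂ × ℂ → ℂ)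
    (hfxxx : fxxx = pdx (pdx (pdx f)))
    (hfxxy : fxxy = pdy (pdx (pdx f)))
    (hfxyy : fxyy = pdy (pdy (pdx f)))
    (hfyyy : fyyy = pdy (pdy (pdy f)))
    (a₀ a₁ a₂ a₃ : ℂ × ℂ → ℂ)
    (ha₀ : a₀ = fxyy) (ha₁ : a₁ = fun z => 2 * fxxy z)
    (ha₂ : a₂ = fxxx) (ha₃ : a₃ = fun _ => -1)
    (E₁ : ℂ × ℂ → ℂ)
    (hE₁ : E₁ = fun z => fyyy z + fxxx z * fxyy z - fxxy z ^ 2)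
    (Δ : ℂ × ℂ → ℂ)
    (hΔ : Δ = fun z => -4 * a₀ z * a₂ z ^ 3 + 18 * a₀ z * a₁ z * a₂ z * a₃ z
        - 27 * a₀ z ^ 2 * a₃ z ^ 2 + a₁ z ^ 2 * a₂ z ^ 2 - 4 * a₁ z ^ 3 * a₃ z)
    (DA DB : ℂ × ℂ → ℂ)
    (hDA : DA = fun z =>
        a₃ z * (2 * a₂ z ^ 2 - 6 * a₁ z * a₃ z) * pdy a₀ z
        + a₃ z * (9 * a₀ z * a₃ z - a₁ z * a₂ z) * (pdx a₀ z + pdy a₁ z)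
        + a₃ z * (2 * a₁ z ^ 2 - 6 * a₀ z * a₂ z) * (pdx a₁ z + pdy a₂ z)
        + (4 * a₀ z * a₂ z ^ 2 - a₁ z ^ 2 * a₂ z - 3 * a₀ z * a₁ z * a₃ z) *
            (pdx a₂ z + pdy a₃ z)
        + (18 * a₀ z ^ 2 * a₃ z - 8 * a₀ z * a₁ z * a₂ z + 2 * a₁ z ^ 3) *
            pdx a₃ z)
    (hDB : DB = fun z =>
        (18 * a₀ z * a₃ z ^ 2 - 8 * a₁ z * a₂ z * a₃ z + 2 * a₂ z ^ 3) *
            pdy a₀ z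
        + (4 * a₁ z ^ 2 * a₃ z - a₁ z * a₂ z ^ 2 - 3 * a₀ z * a₂ z * a₃ z) *
            (pdx a₀ z + pdy a₁ z)
        + a₀ z * (2 * a₂ z ^ 2 - 6 * a₁ z * a₃ z) * (pdx a₁ z + pdy a₂ z)
        + a₀ z * (9 * a₀ z * a₃ z - a₁ z * a₂ z) * (pdx a₂ z + pdy a₃ z)
        + a₀ z * (2 * a₁ z ^ 2 - 6 * a₀ z * a₂ z) * pdx a₃ z) :
    ∀ z ∈ U,
      2 * DA z + pdx Δ z = -4 * pdx E₁ z * (6 * fxxy z + fxxx z ^ 2) ∧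
      2 * DB z + pdy Δ z = -2 * pdx E₁ z * (9 * fxyy z + 2 * fxxx z * fxxy z) := by
  intro z hz
  have hxx := differentiableOn_pdx (differentiableOn_pdx hf hU) hU
  have hxy := differentiableOn_pdy (differentiableOn_pdx hf hU) hU
  have hyy := differentiableOn_pdy (differentiableOn_pdy hf hU) hU
  have hxxy : pdx fxxy z = pdy fxxx z := by
    rw [hfxxy, hfxxx]
    exact pdx_pdy_comm hxx hU hz
  have hxyy : pdx fxyy z = pdy fxxy z := by
    rw [hfxyy, hfxxy, pdx_pdy_comm hxy hU hz]
    exact pdy_congr_of_eqOn hU (pdx_pdy_comm (differentiableOn_pdx hf hU) hU) hz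
  have hyyy : pdx fyyy z = pdy fxyy z := by
    rw [hfyyy, hfxyy, pdx_pdy_comm hyy hU hz]
    refine pdy_congr_of_eqOn hU (fun w hw => ?_) hz
    rw [pdx_pdy_comm (differentiableOn_pdy hf hU) hU hw]
    exact pdy_congr_of_eqOn hU (pdx_pdy_comm hf hU) hw
  have da : DifferentiableAt ℂ fxxx z := by
    rw [hfxxx]
    exact (differentiableOn_pdx hxx hU).differentiableAt (hU.mem_nhds hz)
  have db : DifferentiableAt ℂ fxxy z := by
    rw [hfxxy]
    exact (differentiableOn_pdy hxx hU).differentiableAt (hU.mem_nhds hz)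
  have dc : DifferentiableAt ℂ fxyy z := by
    rw [hfxyy]
    exact (differentiableOn_pdy hxy hU).differentiableAt (hU.mem_nhds hz)
  have de : DifferentiableAt ℂ fyyy z := by
    rw [hfyyy]
    exact (differentiableOn_pdy hyy hU).differentiableAt (hU.mem_nhds hz)
  clear hfxxx hfxxy hfxyy hfyyy
  have ha := da.hasFDerivAt
  have hb := db.hasFDerivAt
  have hc := dc.hasFDerivAt
  have hE := ((de.hasFDerivAt.add (ha.mul hc)).sub (hb.pow 2)).fderiv
  have hb₁ := (hb.const_mul 2).fderiv
  have hD := ((((((hc.const_mul (-4)).mul (ha.pow 3)).add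
    ((((hc.const_mul 18).mul (hb.const_mul 2)).mul ha).mul_const (-1))).sub
    (((hc.pow 2).const_mul 27).mul_const ((-1) ^ 2))).add
    (((hb.const_mul 2).pow 2).mul (ha.pow 2))).sub
    ((((hb.const_mul 2).pow 3).const_mul 4).mul_const (-1))).fderiv
  have hE' := (congrArg (fun g => fderiv ℂ g z) hE₁).trans hE
  have hb' := (congrArg (fun g => fderiv ℂ g z) ha₁).trans hb₁
  rw [ha₀, ha₁, ha₂, ha₃] at hΔ
  have hΔ' := (congrArg (fun g => fderiv ℂ g z) hΔ).trans hD
  have h₃ : fderiv ℂ a₃ z = 0 := by simp [ha₃]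
  rw [hDA, hDB]
  simp only [pdx, pdy] at hxxy hxyy hyyy ⊢
  simp only [hE', hΔ', hb', h₃]
  simp only [ha₀, ha₁, ha₂, ha₃, add_apply, sub_apply,
    smul_apply, smul_eq_mul, zero_apply, Pi.mul_apply, nsmul_eq_mul,
    hxxy, hxyy, hyyy]
  push_cast
  constructor <;> ring
end

section
/- (Weighted Euler symmetry of the web dual to the W-curve p^d = λq^a.) Let d ≥ 1 and 1 ≤ a ≤ d be integers, let λ ∈ ℂ with λ ≠ 0, let U ⊆ ℂ × ℂ be open, and let p : U → ℂ be a differentiable function such that p(x,y)^d = λ·(y − p(x,y)·x)^a and d·p(x,y)^{d−1} + λ·a·x·(y − p(x,y)·x)^{a−1} ≠ 0 for all (x,y) ∈ U. Then the pair (α, β) = ((d−a)·x, d·y) satisfies the symmetry equation with respect to p; explicitly, (d−a)·x·∂xp + d·y·∂yp = a·p on U. (Hence the weighted Euler vector field X = (d−a)x∂x + d y∂y is an infinitesimal symmetry of the linear web ℒ_C(d) dual to the algebraic W-curve with affine equation p^d − λq^a = 0.) -/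
/-- The pair `(α,β)` satisfies the symmetry equation with respect to the slope
function `p` on `U`. -/
def SymmetryEqOn (U : Set (ℂ × ℂ)) (α β p : ℂ × ℂ → ℂ) : Prop :=
  ∀ z ∈ U, -pdx β z + (pdx α z - pdy β z) * p z + pdy α z * p z ^ 2
      + α z * pdx p z + β z * pdy p z = 0

/-- Implicit differentiation of `p ^ d = lam * (y - p x) ^ a` in the direction `v`. -/
theorem fderiv_slope_apply {d a : ℕ} {lam : ℂ} {U : Set (ℂ × ℂ)} (hU : IsOpen U)
    {p : ℂ × ℂ → ℂ} (hp : DifferentiableOn ℂ p U)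
    (hroot : ∀ z ∈ U, p z ^ d = lam * (z.2 - p z * z.1) ^ a)
    {z : ℂ × ℂ} (hz : z ∈ U) (v : ℂ × ℂ) :
    ((d : ℂ) * p z ^ (d - 1) +
        lam * (a : ℂ) * z.1 * (z.2 - p z * z.1) ^ (a - 1)) * fderiv ℂ p z v =
      lam * (a : ℂ) * (z.2 - p z * z.1) ^ (a - 1) * (v.2 - p z * v.1) := by
  have hUz : U ∈ nhds z := hU.mem_nhds hz
  have hpz : HasFDerivAt p (fderiv ℂ p z) z := (hp.differentiableAt hUz).hasFDerivAt
  have hq := (hasFDerivAt_snd (𝕜 := ℂ) (p := z)).sub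
    (hpz.mul (hasFDerivAt_fst (𝕜 := ℂ) (p := z)))
  have heq : (fun w => p w ^ d) =ᶠ[nhds z] fun w => lam * (w.2 - p w * w.1) ^ a :=
    Filter.eventually_of_mem hUz hroot
  have h := DFunLike.congr_fun ((hpz.pow d).unique
    (((hq.pow a).const_mul lam).congr_of_eventuallyEq heq)) v
  simp at h
  linear_combination h

/-- Weighted Euler symmetry of the linear web dual to the W-curve
`p^d = λ q^a`: the vector field `X = (d−a)x∂x + d y∂y` is an infinitesimal
symmetry of every local slope `p` of `p^d = λ(y − px)^a`; explicitly
`(d−a)x·∂xp + d y·∂yp = a·p`. -/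
theorem wcurve_weighted_euler_symmetry
    (d a : ℕ) (ha1 : 1 ≤ a) (had : a ≤ d)
    (lam : ℂ) (hlam : lam ≠ 0)
    (U : Set (ℂ × ℂ)) (hU : IsOpen U)
    (p : ℂ × ℂ → ℂ) (hp : DifferentiableOn ℂ p U)
    (hroot : ∀ z ∈ U, p z ^ d = lam * (z.2 - p z * z.1) ^ a)
    (hsimple : ∀ z ∈ U,
      (d : ℂ) * p z ^ (d - 1) +
        lam * (a : ℂ) * z.1 * (z.2 - p z * z.1) ^ (a - 1) ≠ 0) :
    SymmetryEqOn U (fun w => ((d : ℂ) - (a : ℂ)) * w.1)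
      (fun w => (d : ℂ) * w.2) p ∧
    (∀ z ∈ U,
      ((d : ℂ) - (a : ℂ)) * z.1 * pdx p z + (d : ℂ) * z.2 * pdy p z =
        (a : ℂ) * p z) := by
  have heuler : ∀ z ∈ U,
      ((d : ℂ) - (a : ℂ)) * z.1 * pdx p z + (d : ℂ) * z.2 * pdy p z = (a : ℂ) * p z := by
    intro z hz
    have hx := fderiv_slope_apply hU hp hroot hz (1, 0)
    have hy := fderiv_slope_apply hU hp hroot hz (0, 1)
    have hr := hroot z hz
    rw [← mul_pow_sub_one (by omega : d ≠ 0), ← mul_pow_sub_one (by omega : a ≠ 0)] at hr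
    apply mul_left_cancel₀ (hsimple z hz)
    unfold pdx pdy
    linear_combination ((d : ℂ) - a) * z.1 * hx + (d : ℂ) * z.2 * hy - (a : ℂ) * d * hr
  refine ⟨fun z hz => ?_, heuler⟩
  have hα := (hasFDerivAt_fst (𝕜 := ℂ) (p := z)).const_mul ((d : ℂ) - (a : ℂ))
  have hβ := (hasFDerivAt_snd (𝕜 := ℂ) (p := z)).const_mul (d : ℂ)
  have h := heuler z hz
  simp only [pdx, pdy] at h ⊢
  rw [hα.fderiv, hβ.fderiv]
  simp
  linear_combination h
end

section
/- (Example 3: weighted Euler symmetry of the web p³ + x^m y^n = 0.) Let m, n ∈ ℕ, let U ⊆ ℂ × ℂ be open, and let p : U → ℂ be a differentiable nonvanishing function with p(x,y)³ + x^m·y^n = 0 for all (x,y) ∈ U. Then the pair (α, β) = ((3−n)·x, (3+m)·y) satisfies the symmetry equation with respect to p; explicitly, (3−n)·x·∂xp + (3+m)·y·∂yp = (m+n)·p on U. (Hence X = (3−n)x∂x + (3+m)y∂y is an infinitesimal symmetry of the hexagonal 3-web presented by F = p³ + x^m y^n.) -/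
theorem natCast_mul_pow_pred_mul_self {R : Type*} [CommSemiring R] (k : ℕ) (a : R) :
    (k : R) * a ^ (k - 1) * a = k * a ^ k := by
  cases k with
  | zero => simp
  | succ k => rw [Nat.add_sub_cancel, mul_assoc, ← pow_succ]

theorem hasFDerivAt_cube_add_pow_mul_pow (m n : ℕ) {p : ℂ × ℂ → ℂ} {z : ℂ × ℂ}
    (hp : DifferentiableAt ℂ p z) :
    HasFDerivAt (fun w => p w ^ 3 + w.1 ^ m * w.2 ^ n)
      ((3 * p z ^ 2) • fderiv ℂ p z +
        (z.1 ^ m • (((n : ℂ) * z.2 ^ (n - 1)) • ContinuousLinearMap.snd ℂ ℂ ℂ) +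
          z.2 ^ n • (((m : ℂ) * z.1 ^ (m - 1)) • ContinuousLinearMap.fst ℂ ℂ ℂ))) z := by
  have hcube := (hasDerivAt_pow 3 (p z)).comp_hasFDerivAt z hp.hasFDerivAt
  have hfst := (hasDerivAt_pow m z.1).comp_hasFDerivAt z (hasFDerivAt_fst (𝕜 := ℂ) (p := z))
  have hsnd := (hasDerivAt_pow n z.2).comp_hasFDerivAt z (hasFDerivAt_snd (𝕜 := ℂ) (p := z))
  exact (hcube.add (hfst.mul hsnd)).congr_fderiv (by simp)

/-- On a local root of `p³ + x^m y^n`, the Euler operators `x∂x` and `y∂y` act as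
multiplication by `m/3` and `n/3`. -/
theorem euler_operators_of_cube_add_pow_mul_pow_eq_zero
    (m n : ℕ) {U : Set (ℂ × ℂ)} (hU : IsOpen U)
    {p : ℂ × ℂ → ℂ} (hp : DifferentiableOn ℂ p U)
    (hroot : ∀ z ∈ U, p z ^ 3 + z.1 ^ m * z.2 ^ n = 0)
    {z : ℂ × ℂ} (hz : z ∈ U) (hpz : p z ≠ 0) :
    3 * (z.1 * pdx p z) = m * p z ∧ 3 * (z.2 * pdy p z) = n * p z := by
  have hzU := hU.mem_nhds hz
  have hzero : (fun w => p w ^ 3 + w.1 ^ m * w.2 ^ n) =ᶠ[nhds z] fun _ => 0 :=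
    Filter.eventually_of_mem hzU hroot
  have hD := (hasFDerivAt_cube_add_pow_mul_pow m n (hp.differentiableAt hzU)).unique
    ((hasFDerivAt_const (0 : ℂ) z).congr_of_eventuallyEq hzero)
  have hx : 3 * p z ^ 2 * pdx p z + z.2 ^ n * (m * z.1 ^ (m - 1)) = 0 := by
    simpa [pdx] using DFunLike.congr_fun hD (1, 0)
  have hy : 3 * p z ^ 2 * pdy p z + z.1 ^ m * (n * z.2 ^ (n - 1)) = 0 := by
    simpa [pdy] using DFunLike.congr_fun hD (0, 1)
  have hm := natCast_mul_pow_pred_mul_self m z.1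
  have hn := natCast_mul_pow_pred_mul_self n z.2
  have hr := hroot z hz
  constructor <;> apply mul_left_cancel₀ (pow_ne_zero 2 hpz)
  · linear_combination z.1 * hx - z.2 ^ n * hm - m * hr
  · linear_combination z.2 * hy - z.1 ^ m * hn - n * hr

theorem pdx_const_mul_fst (c : ℂ) (z : ℂ × ℂ) : pdx (fun w => c * w.1) z = c := by
  simp [pdx, (hasFDerivAt_fst (𝕜 := ℂ) (p := z)).const_mul c |>.fderiv]

theorem pdy_const_mul_fst (c : ℂ) (z : ℂ × ℂ) : pdy (fun w => c * w.1) z = 0 := by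
  simp [pdy, (hasFDerivAt_fst (𝕜 := ℂ) (p := z)).const_mul c |>.fderiv]

theorem pdx_const_mul_snd (c : ℂ) (z : ℂ × ℂ) : pdx (fun w => c * w.2) z = 0 := by
  simp [pdx, (hasFDerivAt_snd (𝕜 := ℂ) (p := z)).const_mul c |>.fderiv]

theorem pdy_const_mul_snd (c : ℂ) (z : ℂ × ℂ) : pdy (fun w => c * w.2) z = c := by
  simp [pdy, (hasFDerivAt_snd (𝕜 := ℂ) (p := z)).const_mul c |>.fderiv]

/-- Example 3: the weighted Euler vector field `X = (3−n)x∂x + (3+m)y∂y` is an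
infinitesimal symmetry of the hexagonal 3-web presented by `F = p³ + x^m y^n`;
explicitly `(3−n)x·∂xp + (3+m)y·∂yp = (m+n)·p` for every local root `p`. -/
theorem xmyn_weighted_euler_symmetry
    (m n : ℕ) (U : Set (ℂ × ℂ)) (hU : IsOpen U)
    (p : ℂ × ℂ → ℂ) (hp : DifferentiableOn ℂ p U)
    (hpne : ∀ z ∈ U, p z ≠ 0)
    (hroot : ∀ z ∈ U, p z ^ 3 + z.1 ^ m * z.2 ^ n = 0) :
    SymmetryEqOn U (fun w => ((3 : ℂ) - (n : ℂ)) * w.1)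
      (fun w => ((3 : ℂ) + (m : ℂ)) * w.2) p ∧
    (∀ z ∈ U,
      ((3 : ℂ) - (n : ℂ)) * z.1 * pdx p z +
        ((3 : ℂ) + (m : ℂ)) * z.2 * pdy p z = ((m : ℂ) + (n : ℂ)) * p z) := by
  have heuler : ∀ z ∈ U,
      ((3 : ℂ) - (n : ℂ)) * z.1 * pdx p z +
        ((3 : ℂ) + (m : ℂ)) * z.2 * pdy p z = ((m : ℂ) + (n : ℂ)) * p z := by
    intro z hz
    obtain ⟨hx, hy⟩ :=
      euler_operators_of_cube_add_pow_mul_pow_eq_zero m n hU hp hroot hz (hpne z hz)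
    linear_combination (3 - (n : ℂ)) / 3 * hx + (3 + (m : ℂ)) / 3 * hy
  refine ⟨fun z hz => ?_, heuler⟩
  rw [pdx_const_mul_fst, pdy_const_mul_fst, pdx_const_mul_snd, pdy_const_mul_snd]
  linear_combination heuler z hz
end

section
/- (Example 3: the other symmetries of the web p³ + x^m y^n = 0.) Let m, n ∈ ℕ, let U ⊆ ℂ × ℂ be open with x ≠ 0 and y ≠ 0 on U, and let p : U → ℂ be a differentiable nonvanishing function with p(x,y)³ + x^m·y^n = 0 on U. (1) If a : U → ℂ is differentiable with ∂y a = 0 and 3x·∂x a = −m·a on U (so a is a branch of x^{−m/3}), then the pair (a, 0) satisfies the symmetry equation with respect to p. (2) If b : U → ℂ is differentiable with ∂x b = 0 and 3y·∂y b = n·b on U (so b is a branch of y^{n/3}), then the pair (0, b) satisfies the symmetry equation with respect to p. -/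
theorem fderiv_apply_of_pow_three_add_eq_zero {m n : ℕ} {U : Set (ℂ × ℂ)} (hU : IsOpen U)
    {p : ℂ × ℂ → ℂ} (hp : DifferentiableOn ℂ p U)
    (hroot : ∀ z ∈ U, p z ^ 3 + z.1 ^ m * z.2 ^ n = 0) {z : ℂ × ℂ} (hz : z ∈ U) (v : ℂ × ℂ) :
    3 * p z ^ 2 * fderiv ℂ p z v + (z.1 ^ m * (n * z.2 ^ (n - 1) * v.2)
      + z.2 ^ n * (m * z.1 ^ (m - 1) * v.1)) = 0 := by
  have hpz : HasFDerivAt p (fderiv ℂ p z) z :=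
    (hp.differentiableAt (hU.mem_nhds hz)).hasFDerivAt
  have h := (hpz.pow 3).add
    (((hasFDerivAt_fst (𝕜 := ℂ) (p := z)).pow m).mul ((hasFDerivAt_snd (𝕜 := ℂ) (p := z)).pow n))
  have h0 : HasFDerivAt (fun w : ℂ × ℂ => p w ^ 3 + w.1 ^ m * w.2 ^ n) (0 : ℂ × ℂ →L[ℂ] ℂ) z :=
    (hasFDerivAt_const (0 : ℂ) z).congr_of_eventuallyEq
      (Filter.eventually_of_mem (hU.mem_nhds hz) hroot)
  simpa using congrArg (fun L : ℂ × ℂ →L[ℂ] ℂ => L v) (h.unique h0)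

theorem mul_natCast_mul_pow_pred (k : ℕ) (x : ℂ) : x * (k * x ^ (k - 1)) = k * x ^ k := by
  cases k with
  | zero => simp
  | succ k => rw [Nat.add_sub_cancel, pow_succ]; ring

/-- Example 3, the other symmetries of the web `p³ + x^m y^n = 0`: a branch
`a` of `x^{−m/3}` gives the symmetry `a·∂x`, and a branch `b` of `y^{n/3}`
gives the symmetry `b·∂y`. -/
theorem xmyn_other_symmetries
    (m n : ℕ) (U : Set (ℂ × ℂ)) (hU : IsOpen U)
    (hx : ∀ z ∈ U, z.1 ≠ 0) (hy : ∀ z ∈ U, z.2 ≠ 0)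
    (p : ℂ × ℂ → ℂ) (hp : DifferentiableOn ℂ p U)
    (hpne : ∀ z ∈ U, p z ≠ 0)
    (hroot : ∀ z ∈ U, p z ^ 3 + z.1 ^ m * z.2 ^ n = 0) :
    (∀ a : ℂ × ℂ → ℂ, DifferentiableOn ℂ a U →
      (∀ z ∈ U, pdy a z = 0) →
      (∀ z ∈ U, 3 * z.1 * pdx a z = -(m : ℂ) * a z) →
      SymmetryEqOn U a (fun _ => 0) p) ∧
    (∀ b : ℂ × ℂ → ℂ, DifferentiableOn ℂ b U →
      (∀ z ∈ U, pdx b z = 0) →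
      (∀ z ∈ U, 3 * z.2 * pdy b z = (n : ℂ) * b z) →
      SymmetryEqOn U (fun _ => 0) b p) := by
  have hpx : ∀ z ∈ U, 3 * z.1 * pdx p z = m * p z := fun z hz => by
    have h := fderiv_apply_of_pow_three_add_eq_zero hU hp hroot hz (1, 0)
    simp only [mul_zero, mul_one, zero_add] at h
    apply mul_left_cancel₀ (pow_ne_zero 2 (hpne z hz))
    unfold pdx
    linear_combination z.1 * h - z.2 ^ n * mul_natCast_mul_pow_pred m z.1 - m * hroot z hz
  have hpy : ∀ z ∈ U, 3 * z.2 * pdy p z = n * p z := fun z hz => by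
    have h := fderiv_apply_of_pow_three_add_eq_zero hU hp hroot hz (0, 1)
    simp only [mul_zero, mul_one, add_zero] at h
    apply mul_left_cancel₀ (pow_ne_zero 2 (hpne z hz))
    unfold pdy
    linear_combination z.2 * h - z.1 ^ m * mul_natCast_mul_pow_pred n z.2 - n * hroot z hz
  have hx0 : ∀ z, pdx (fun _ => 0) z = 0 := fun z => by simp [pdx]
  have hy0 : ∀ z, pdy (fun _ => 0) z = 0 := fun z => by simp [pdy]
  refine ⟨fun a _ hay hax z hz => ?_, fun b _ hbx hby z hz => ?_⟩
  · rw [hx0, hy0, hay z hz]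
    apply mul_left_cancel₀ (mul_ne_zero three_ne_zero (hx z hz))
    linear_combination p z * hax z hz + a z * hpx z hz
  · rw [hx0, hy0, hbx z hz]
    apply mul_left_cancel₀ (mul_ne_zero three_ne_zero (hy z hz))
    linear_combination -p z * hby z hz + b z * hpy z hz
end

section
/- (Example 2: the multivalued logarithmic symmetry.) Let U ⊆ ℂ × ℂ be open with x ≠ 0 and y² − x² ≠ 0 on U, and let L₁, L₂ : U → ℂ be differentiable functions satisfying ∂xL₁ = −2x/(y²−x²), ∂yL₁ = 2y/(y²−x²), ∂xL₂ = 2y/(y²−x²), ∂yL₂ = −2x/(y²−x²) on U (so L₁ is a branch of log(y²−x²) and L₂ a branch of log((y+x)/(y−x))). Then the pair (α, β) = (x·L₁ + y·L₂, y·L₁ + x·L₂) satisfies the symmetry equation with respect to each of the three slope functions p₁ ≡ 1, p₂ ≡ −1 and p₃(x,y) = y/x. -/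
/-- Product rule for `z ↦ z.1 * f z + z.2 * g z` in the two coordinate directions. -/
theorem pdx_pdy_fst_mul_add_snd_mul {f g : ℂ × ℂ → ℂ} {z : ℂ × ℂ}
    (hf : DifferentiableAt ℂ f z) (hg : DifferentiableAt ℂ g z) :
    pdx (fun w => w.1 * f w + w.2 * g w) z = f z + z.1 * pdx f z + z.2 * pdx g z ∧
    pdy (fun w => w.1 * f w + w.2 * g w) z = z.1 * pdy f z + g z + z.2 * pdy g z := by
  have h := (hasFDerivAt_fst.mul hf.hasFDerivAt).add (hasFDerivAt_snd.mul hg.hasFDerivAt)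
  have h' : HasFDerivAt (fun w : ℂ × ℂ => w.1 * f w + w.2 * g w) _ z := h
  simp only [pdx, pdy, h'.fderiv]
  constructor <;> simp <;> ring

theorem pdx_pdy_snd_div_fst {z : ℂ × ℂ} (hz : z.1 ≠ 0) :
    pdx (fun w => w.2 / w.1) z = -z.2 / z.1 ^ 2 ∧ pdy (fun w => w.2 / w.1) z = 1 / z.1 := by
  have hfst : HasFDerivAt (fun w : ℂ × ℂ => w.1) (ContinuousLinearMap.fst ℂ ℂ ℂ) z :=
    hasFDerivAt_fst
  have hsnd : HasFDerivAt (fun w : ℂ × ℂ => w.2) (ContinuousLinearMap.snd ℂ ℂ ℂ) z :=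
    hasFDerivAt_snd
  have h := hsnd.mul ((hasDerivAt_inv hz).comp_hasFDerivAt z hfst)
  replace h : HasFDerivAt (fun w : ℂ × ℂ => w.2 / w.1) _ z :=
    h.congr_of_eventuallyEq (.of_forall fun w => div_eq_mul_inv w.2 w.1)
  simp only [pdx, pdy, h.fderiv]
  constructor <;> simp <;> field_simp

/-- Example 2, the multivalued logarithmic symmetry: with `L₁` a branch of
`log(y²−x²)` and `L₂` a branch of `log((y+x)/(y−x))`, the vector field
`(xL₁ + yL₂)∂x + (yL₁ + xL₂)∂y` is an infinitesimal symmetry of the 3-web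
with slope functions `1`, `−1` and `y/x`. -/
theorem three_pencils_logarithmic_symmetry
    (U : Set (ℂ × ℂ)) (hU : IsOpen U)
    (hx : ∀ z ∈ U, z.1 ≠ 0) (hxy : ∀ z ∈ U, z.2 ^ 2 - z.1 ^ 2 ≠ 0)
    (L₁ L₂ : ℂ × ℂ → ℂ)
    (hL₁ : DifferentiableOn ℂ L₁ U) (hL₂ : DifferentiableOn ℂ L₂ U)
    (hL₁x : ∀ z ∈ U, pdx L₁ z = -2 * z.1 / (z.2 ^ 2 - z.1 ^ 2))
    (hL₁y : ∀ z ∈ U, pdy L₁ z = 2 * z.2 / (z.2 ^ 2 - z.1 ^ 2))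
    (hL₂x : ∀ z ∈ U, pdx L₂ z = 2 * z.2 / (z.2 ^ 2 - z.1 ^ 2))
    (hL₂y : ∀ z ∈ U, pdy L₂ z = -2 * z.1 / (z.2 ^ 2 - z.1 ^ 2)) :
    SymmetryEqOn U (fun w => w.1 * L₁ w + w.2 * L₂ w)
      (fun w => w.2 * L₁ w + w.1 * L₂ w) (fun _ => 1) ∧
    SymmetryEqOn U (fun w => w.1 * L₁ w + w.2 * L₂ w)
      (fun w => w.2 * L₁ w + w.1 * L₂ w) (fun _ => -1) ∧
    SymmetryEqOn U (fun w => w.1 * L₁ w + w.2 * L₂ w)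
      (fun w => w.2 * L₁ w + w.1 * L₂ w) (fun w => w.2 / w.1) := by
  have key : ∀ z ∈ U,
      pdx (fun w => w.1 * L₁ w + w.2 * L₂ w) z = L₁ z + 2 ∧
      pdy (fun w => w.1 * L₁ w + w.2 * L₂ w) z = L₂ z ∧
      pdx (fun w => w.2 * L₁ w + w.1 * L₂ w) z = L₂ z ∧
      pdy (fun w => w.2 * L₁ w + w.1 * L₂ w) z = L₁ z + 2 := by
    intro z hz
    have d₁ := hL₁.differentiableAt (hU.mem_nhds hz)
    have d₂ := hL₂.differentiableAt (hU.mem_nhds hz)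
    have hD := hxy z hz
    obtain ⟨ax, ay⟩ := pdx_pdy_fst_mul_add_snd_mul d₁ d₂
    obtain ⟨bx, byy⟩ := pdx_pdy_fst_mul_add_snd_mul d₂ d₁
    simp only [add_comm (_ * L₁ _) (_ * L₂ _)] at ax ay ⊢
    rw [ax, ay, bx, byy, hL₁x z hz, hL₁y z hz, hL₂x z hz, hL₂y z hz]
    refine ⟨?_, ?_, ?_, ?_⟩ <;> field_simp <;> ring
  have hc : ∀ (c : ℂ) (z : ℂ × ℂ), pdx (fun _ => c) z = 0 ∧ pdy (fun _ => c) z = 0 := by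
    intro c z
    simp [pdx, pdy]
  refine ⟨fun z hz => ?_, fun z hz => ?_, fun z hz => ?_⟩ <;>
    obtain ⟨ax, ay, bx, byy⟩ := key z hz
  · rw [ax, ay, bx, byy, (hc 1 z).1, (hc 1 z).2]
    ring
  · rw [ax, ay, bx, byy, (hc (-1) z).1, (hc (-1) z).2]
    ring
  · obtain ⟨px, py⟩ := pdx_pdy_snd_div_fst (hx z hz)
    have hz₁ := hx z hz
    rw [ax, ay, bx, byy, px, py]
    field_simp
    ring
end

section
/- (Marín's sharp example.) Let U ⊆ ℂ × ℂ be open with x ≠ 0 and y ≠ 0 on U, let λ ∈ ℂ, and let p_λ : U → ℂ be the slope function p_λ(x,y) = λ·y/x. Then: (1) the pairs (α, β) = (x, 0) and (α, β) = (0, y) satisfy the symmetry equation with respect to p_λ; and (2) if L_x, L_y : U → ℂ are differentiable with ∂xL_x = 1/x, ∂yL_x = 0, ∂xL_y = 0, ∂yL_y = 1/y on U (branches of log x and log y), then the pair (α, β) = (x·L_x, y·L_y) also satisfies the symmetry equation with respect to p_λ. (Hence x∂x, y∂y and x log x ∂x + y log y ∂y are infinitesimal symmetries of the d-web presented by F =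 ∏ᵢ(x·p − λᵢ·y) for any pairwise distinct λ₁,…,λ_d.) -/
theorem pdx_fst (z : ℂ × ℂ) : pdx (fun w => w.1) z = 1 := by
  simp [pdx, fderiv_fst]

theorem pdy_fst (z : ℂ × ℂ) : pdy (fun w => w.1) z = 0 := by
  simp [pdy, fderiv_fst]

theorem pdx_snd (z : ℂ × ℂ) : pdx (fun w => w.2) z = 0 := by
  simp [pdx, fderiv_snd]

theorem pdy_snd (z : ℂ × ℂ) : pdy (fun w => w.2) z = 1 := by
  simp [pdy, fderiv_snd]

theorem pdx_const (c : ℂ) (z : ℂ × ℂ) : pdx (fun _ => c) z = 0 := by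
  simp [pdx]

theorem pdy_const (c : ℂ) (z : ℂ × ℂ) : pdy (fun _ => c) z = 0 := by
  simp [pdy]

theorem pdx_mul {f g : ℂ × ℂ → ℂ} {z : ℂ × ℂ} (hf : DifferentiableAt ℂ f z)
    (hg : DifferentiableAt ℂ g z) :
    pdx (fun w => f w * g w) z = f z * pdx g z + g z * pdx f z := by
  simp [pdx, fderiv_fun_mul hf hg]

theorem pdy_mul {f g : ℂ × ℂ → ℂ} {z : ℂ × ℂ} (hf : DifferentiableAt ℂ f z)
    (hg : DifferentiableAt ℂ g z) :
    pdy (fun w => f w * g w) z = f z * pdy g z + g z * pdy f z := by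
  simp [pdy, fderiv_fun_mul hf hg]

theorem hasFDerivAt_slope (c : ℂ) {z : ℂ × ℂ} (hz : z.1 ≠ 0) :
    HasFDerivAt (fun w : ℂ × ℂ => c * w.2 / w.1)
      ((c * z.2) • (-(z.1 ^ 2)⁻¹ • ContinuousLinearMap.fst ℂ ℂ ℂ) +
        z.1⁻¹ • (c • ContinuousLinearMap.snd ℂ ℂ ℂ)) z := by
  simp only [div_eq_mul_inv]
  exact (hasFDerivAt_snd.const_mul c).mul
    ((hasDerivAt_inv hz).comp_hasFDerivAt z hasFDerivAt_fst)

theorem pdx_slope (c : ℂ) {z : ℂ × ℂ} (hz : z.1 ≠ 0) :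
    pdx (fun w => c * w.2 / w.1) z = -(c * z.2 / z.1 ^ 2) := by
  rw [pdx, (hasFDerivAt_slope c hz).fderiv]
  simp [div_eq_mul_inv]

theorem pdy_slope (c : ℂ) {z : ℂ × ℂ} (hz : z.1 ≠ 0) :
    pdy (fun w => c * w.2 / w.1) z = c / z.1 := by
  rw [pdy, (hasFDerivAt_slope c hz).fderiv]
  simp [div_eq_mul_inv, mul_comm]

/-- Marín's sharp example: for the slope function `p_λ = λ·y/x`, the vector
fields `x∂x`, `y∂y` and `x log x ∂x + y log y ∂y` (with `L_x`, `L_y` branches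
of `log x`, `log y`) are infinitesimal symmetries. -/
theorem marin_sharp_example
    (U : Set (ℂ × ℂ)) (hU : IsOpen U)
    (hx : ∀ z ∈ U, z.1 ≠ 0) (hy : ∀ z ∈ U, z.2 ≠ 0)
    (lam : ℂ) :
    SymmetryEqOn U (fun w => w.1) (fun _ => 0)
      (fun w => lam * w.2 / w.1) ∧
    SymmetryEqOn U (fun _ => 0) (fun w => w.2)
      (fun w => lam * w.2 / w.1) ∧
    (∀ Lx Ly : ℂ × ℂ → ℂ,
      DifferentiableOn ℂ Lx U → DifferentiableOn ℂ Ly U →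
      (∀ z ∈ U, pdx Lx z = 1 / z.1) → (∀ z ∈ U, pdy Lx z = 0) →
      (∀ z ∈ U, pdx Ly z = 0) → (∀ z ∈ U, pdy Ly z = 1 / z.2) →
      SymmetryEqOn U (fun w => w.1 * Lx w) (fun w => w.2 * Ly w)
        (fun w => lam * w.2 / w.1)) := by
  refine ⟨fun z hz => ?_, fun z hz => ?_, fun Lx Ly hLx hLy hxx hxy hyx hyy z hz => ?_⟩
  · have hz1 := hx z hz
    rw [pdx_const, pdx_fst, pdy_const, pdy_fst, pdx_slope lam hz1, pdy_slope lam hz1]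
    field_simp
    ring
  · have hz1 := hx z hz
    rw [pdx_snd, pdx_const, pdy_snd, pdy_const, pdx_slope lam hz1, pdy_slope lam hz1]
    field_simp
    ring
  · have hz1 := hx z hz
    have hz2 := hy z hz
    have hdx := hLx.differentiableAt (hU.mem_nhds hz)
    have hdy := hLy.differentiableAt (hU.mem_nhds hz)
    rw [pdx_mul differentiableAt_snd hdy, pdx_mul differentiableAt_fst hdx,
      pdy_mul differentiableAt_snd hdy, pdy_mul differentiableAt_fst hdx,
      pdx_slope lam hz1, pdy_slope lam hz1, pdx_fst, pdy_fst, pdx_snd, pdy_snd,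
      hxx z hz, hxy z hz, hyx z hz, hyy z hz]
    field_simp
    ring
end
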